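/- There exists a constant C > 0 (depending only on g) such that for every n ≥ 0, sup_{x∈ℝ} |log gₙ′(x)| ≤ C · Mₙ^{1/2}, where gₙ′ denotes the derivative of gₙ(x) = g^{qₙ}(x) − pₙ. -/

import Mathlib

open Filter Topology

/-- Gauss-map orbit of `α`: `α₀ = α`, `αₙ₊₁ = 1 / fract(αₙ)`. -/
noncomputable def cfGauss (α : ℝ) : ℕ → ℝ
  | 0 => α
  | n + 1 => (Int.fract (cfGauss α n))⁻¹

/-- Partial quotients `aₙ` of the continued fraction of `α`. -/
noncomputable def cfA (α : ℝ) (n : ℕ) : ℤ := ⌊cfGauss α n⌋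

/-- Numerators `pₙ` of the convergents of `α`. -/
noncomputable def cfP (α : ℝ) : ℕ → ℤ
  | 0 => cfA α 0
  | 1 => cfA α 1 * cfA α 0 + 1
  | n + 2 => cfA α (n + 2) * cfP α (n + 1) + cfP α n

/-- Denominators `qₙ` of the convergents of `α` (as natural numbers). -/
noncomputable def cfQ (α : ℝ) : ℕ → ℕ
  | 0 => 1
  | 1 => (cfA α 1).toNat
  | n + 2 => (cfA α (n + 2)).toNat * cfQ α (n + 1) + cfQ α n

/-- `gₙ(x) = g^{qₙ}(x) − pₙ`. -/
noncomputable def cfIter (g : ℝ → ℝ) (α : ℝ) (n : ℕ) (x : ℝ) : ℝ :=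
  g^[cfQ α n] x - cfP α n

/-! ### Continued fractions -/

lemma cfGauss_irr {α : ℝ} (hα : Irrational α) : ∀ n, Irrational (cfGauss α n)
  | 0 => hα
  | n + 1 => by
    have h := cfGauss_irr hα n
    have : Irrational (Int.fract (cfGauss α n)) := by
      rw [Int.fract]; exact h.sub_intCast _
    simpa [cfGauss] using this.inv

lemma cf_fract_pos {α : ℝ} (hα : Irrational α) (n : ℕ) : 0 < Int.fract (cfGauss α n) := by
  rcases (Int.fract_nonneg (cfGauss α n)).lt_or_eq with h | h
  · exact h
  · exfalso
    have h2 : Irrational (Int.fract (cfGauss α n)) := by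
      rw [Int.fract]; exact (cfGauss_irr hα n).sub_intCast _
    rw [← h] at h2
    exact h2.ne_zero rfl

lemma cfA_pos {α : ℝ} (hα : Irrational α) (n : ℕ) : 1 ≤ cfA α (n + 1) := by
  unfold cfA
  rw [Int.le_floor]
  have h1 := cf_fract_pos hα n
  have h2 := (Int.fract_lt_one (cfGauss α n)).le
  simp only [cfGauss]
  push_cast
  exact (one_le_inv₀ h1).2 h2

lemma cfA_toNat {α : ℝ} (hα : Irrational α) (n : ℕ) :
    (((cfA α (n + 1)).toNat : ℕ) : ℤ) = cfA α (n + 1) :=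
  Int.toNat_of_nonneg (by have := cfA_pos hα n; omega)

lemma cfQ_pos {α : ℝ} (hα : Irrational α) : ∀ n, 1 ≤ cfQ α n
  | 0 => by simp [cfQ]
  | 1 => by have : 1 ≤ cfA α 1 := cfA_pos hα 0; simp only [cfQ]; omega
  | n + 2 => by have := cfQ_pos hα n; simp only [cfQ]; omega

lemma cfQ_mono {α : ℝ} (hα : Irrational α) : ∀ n, cfQ α n ≤ cfQ α (n + 1)
  | 0 => by have : 1 ≤ cfA α 1 := cfA_pos hα 0; simp only [cfQ]; omega
  | n + 1 => by
    have h := cfA_pos hα (n + 1)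
    have h1 : 1 ≤ (cfA α (n + 2)).toNat := by
      have : (1:ℤ) ≤ cfA α (n + 2) := h
      omega
    simp only [cfQ]
    nlinarith [Nat.zero_le (cfQ α n), Nat.zero_le (cfQ α (n + 1)), Nat.mul_le_mul_right (cfQ α (n+1)) h1]

lemma cf_delta {α : ℝ} (hα : Irrational α) : ∀ n,
    (cfQ α (n + 1) : ℝ) * α - cfP α (n + 1) =
      -(Int.fract (cfGauss α (n + 1))) * ((cfQ α n : ℝ) * α - cfP α n)
  | 0 => by
    have h0 := cf_fract_pos hα 0
    have e : ((cfA α 1).toNat : ℝ) = (cfA α 1 : ℝ) := by exact_mod_cast cfA_toNat hα 0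
    have e1 : Int.fract (cfGauss α (0 + 1)) = (Int.fract (cfGauss α 0))⁻¹ - cfA α 1 := by
      rw [Int.fract]; rfl
    have e0 : Int.fract (cfGauss α 0) = α - cfA α 0 := by rw [Int.fract]; rfl
    rw [e1]
    simp only [cfQ, cfP]
    rw [e]
    rw [e0] at h0 ⊢
    push_cast
    field_simp
    ring
  | n + 1 => by
    have ih := cf_delta hα n
    have h0 := cf_fract_pos hα (n + 1)
    have e : ((cfA α (n + 2)).toNat : ℝ) = (cfA α (n + 2) : ℝ) := by
      exact_mod_cast cfA_toNat hα (n + 1)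
    have e1 : Int.fract (cfGauss α (n + 1 + 1)) =
        (Int.fract (cfGauss α (n + 1)))⁻¹ - cfA α (n + 2) := by
      rw [Int.fract]; rfl
    rw [e1]
    have l1 : (cfQ α (n + 1 + 1) : ℝ) = cfA α (n + 2) * cfQ α (n + 1) + cfQ α n := by
      simp only [cfQ]; push_cast; rw [e]
    have l2 : (cfP α (n + 1 + 1) : ℝ) = cfA α (n + 2) * cfP α (n + 1) + cfP α n := by
      simp only [cfP]; push_cast; rfl
    rw [l1, l2]
    have : (cfQ α n : ℝ) * α - cfP α n =
        -(Int.fract (cfGauss α (n + 1)))⁻¹ * ((cfQ α (n + 1) : ℝ) * α - cfP α (n + 1)) := by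
      rw [ih]; field_simp
    linear_combination this

lemma cf_det {α : ℝ} (hα : Irrational α) : ∀ n,
    (cfP α (n + 1) * cfQ α n - cfP α n * cfQ α (n + 1)) ^ 2 = 1
  | 0 => by
    have e := cfA_toNat hα 0
    simp only [cfQ, cfP, zero_add] at *
    rw [e]; push_cast; ring
  | n + 1 => by
    have ih := cf_det hα n
    have e := cfA_toNat hα (n + 1)
    have l1 : (cfQ α (n + 1 + 1) : ℤ) = cfA α (n + 2) * cfQ α (n + 1) + cfQ α n := by
      simp only [cfQ]; push_cast; rw [e]
    have l2 : (cfP α (n + 1 + 1) : ℤ) = cfA α (n + 2) * cfP α (n + 1) + cfP α n := by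
      simp only [cfP]
    rw [l1, l2]
    linear_combination ih

/-- Arithmetic facts about two consecutive convergents. -/
structure CFPair (α : ℝ) (q Q : ℕ) (p P : ℤ) : Prop where
  q_pos : 1 ≤ q
  q_le : q ≤ Q
  lt_one : |(q : ℝ) * α - p| < 1
  opp : ((q : ℝ) * α - p) * ((Q : ℝ) * α - P) < 0
  le : |(Q : ℝ) * α - P| ≤ |(q : ℝ) * α - p|
  best : ∀ i : ℕ, 0 < i → i < Q → ∀ k : ℤ, |(q : ℝ) * α - p| ≤ |(i : ℝ) * α - k|

lemma cf_lt_one {α : ℝ} (hα : Irrational α) : ∀ n, |(cfQ α n : ℝ) * α - cfP α n| < 1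
  | 0 => by
    have e0 : Int.fract (cfGauss α 0) = α - cfA α 0 := by rw [Int.fract]; rfl
    simp only [cfQ, cfP, Nat.cast_one, one_mul]
    rw [← e0, abs_of_nonneg (Int.fract_nonneg _)]
    exact Int.fract_lt_one _
  | n + 1 => by
    have h := cf_lt_one hα n
    rw [cf_delta hα n, abs_mul, abs_neg, abs_of_nonneg (Int.fract_nonneg _)]
    have h1 := Int.fract_lt_one (cfGauss α (n + 1))
    have h2 := Int.fract_nonneg (cfGauss α (n + 1))
    nlinarith [abs_nonneg ((cfQ α n : ℝ) * α - cfP α n)]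

lemma cf_ne {α : ℝ} (hα : Irrational α) (n : ℕ) : (cfQ α n : ℝ) * α - cfP α n ≠ 0 := by
  have h := cfQ_pos hα n
  have : Irrational ((cfQ α n : ℝ) * α - cfP α n) :=
    (hα.natCast_mul (by omega)).sub_intCast _
  exact this.ne_zero

lemma cf_pair {α : ℝ} (hα : Irrational α) (n : ℕ) :
    CFPair α (cfQ α n) (cfQ α (n + 1)) (cfP α n) (cfP α (n + 1)) := by
  have hθ0 := cf_fract_pos hα (n + 1)
  have hθ1 := Int.fract_lt_one (cfGauss α (n + 1))
  have hd := cf_delta hα n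
  have hne := cf_ne hα n
  have hopp : ((cfQ α n : ℝ) * α - cfP α n) * ((cfQ α (n + 1) : ℝ) * α - cfP α (n + 1)) < 0 := by
    rw [hd]
    have := mul_self_pos.2 hne
    nlinarith
  refine ⟨cfQ_pos hα n, cfQ_mono hα n, cf_lt_one hα n, hopp, ?_, ?_⟩
  · rw [hd, abs_mul, abs_neg, abs_of_pos hθ0]
    nlinarith [abs_nonneg ((cfQ α n : ℝ) * α - cfP α n)]
  · intro i hi0 hi k
    have hdet := cf_det hα n
    have hqp := cfQ_pos hα n
    obtain ⟨u, v, hu, hv⟩ : ∃ u v : ℤ, (i : ℤ) = u * cfQ α n + v * cfQ α (n + 1) ∧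
        k = u * cfP α n + v * cfP α (n + 1) := by
      set D := cfP α (n + 1) * cfQ α n - cfP α n * cfQ α (n + 1) with hD
      refine ⟨D * (i * cfP α (n + 1) - k * cfQ α (n + 1)), D * (k * cfQ α n - i * cfP α n), ?_, ?_⟩
      · have : D * (i * cfP α (n + 1) - k * cfQ α (n + 1)) * cfQ α n +
          D * (k * cfQ α n - i * cfP α n) * cfQ α (n + 1) = D ^ 2 * i := by rw [hD]; ring
        rw [this, hdet]; ring
      · have : D * (i * cfP α (n + 1) - k * cfQ α (n + 1)) * cfP α n +
          D * (k * cfQ α n - i * cfP α n) * cfP α (n + 1) = D ^ 2 * k := by rw [hD]; ring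
        rw [this, hdet]; ring
    have key : (i : ℝ) * α - k = u * ((cfQ α n : ℝ) * α - cfP α n) +
        v * ((cfQ α (n + 1) : ℝ) * α - cfP α (n + 1)) := by
      have h1 : (i : ℝ) = u * cfQ α n + v * cfQ α (n + 1) := by exact_mod_cast hu
      have h2 : (k : ℝ) = u * cfP α n + v * cfP α (n + 1) := by exact_mod_cast hv
      rw [h1, h2]; ring
    rw [key]
    set d := (cfQ α n : ℝ) * α - cfP α n
    set e := (cfQ α (n + 1) : ℝ) * α - cfP α (n + 1)
    have hq1 : (1:ℤ) ≤ cfQ α n := by exact_mod_cast hqp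
    have hq2 : (1:ℤ) ≤ cfQ α (n + 1) := by exact_mod_cast cfQ_pos hα (n + 1)
    have hi0' : (0:ℤ) < i := by exact_mod_cast hi0
    have hi' : (i:ℤ) < cfQ α (n + 1) := by exact_mod_cast hi
    have hu0 : u ≠ 0 := by
      rintro rfl
      have hv1 : 0 < v := by nlinarith
      nlinarith
    have huv : u * v ≤ 0 := by
      by_contra hc
      push Not at hc
      rcases lt_or_gt_of_ne hu0 with h | h
      · have : v < 0 := by nlinarith
        nlinarith
      · have : 0 < v := by nlinarith
        nlinarith
    have hu1 : (1:ℝ) ≤ (u:ℝ)^2 := by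
      have : (1:ℤ) ≤ u^2 := by have := sq_pos_of_ne_zero hu0; omega
      exact_mod_cast this
    have huvR : (u:ℝ) * v ≤ 0 := by exact_mod_cast huv
    apply sq_le_sq.1
    have : 0 ≤ ((u:ℝ) * v) * (d * e) := by nlinarith
    nlinarith [sq_nonneg (v * e), sq_nonneg d]

/-! ### Ordering of orbits -/

lemma iter_add_int {f : ℝ → ℝ} (hper : ∀ x, f (x + 1) = f x + 1) (hm : StrictMono f) (i : ℕ)
    (x : ℝ) (k : ℤ) : f^[i] (x + k) = f^[i] x + k := by
  let F : CircleDeg1Lift := ⟨⟨f, hm.monotone⟩, hper⟩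
  have h := (F ^ i).map_add_int x k
  rw [CircleDeg1Lift.coe_pow] at h
  exact h

/-- Orbits of `f` are ordered as those of the rotation by `α`. -/
lemma orbit_lt {f : ℝ → ℝ} (hper : ∀ x, f (x + 1) = f x + 1) (hm : StrictMono f) {α : ℝ}
    (hrot : ∀ x : ℝ, Tendsto (fun m : ℕ => (f^[m] x - x) / m) atTop (𝓝 α))
    (i j : ℕ) (k l : ℤ) (h : (i : ℝ) * α + k < j * α + l) (x : ℝ) :
    f^[i] x + k < f^[j] x + l := by
  let F : CircleDeg1Lift := ⟨⟨f, hm.monotone⟩, hper⟩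
  have hτ : F.translationNumber = α := by
    have h1 := F.tendsto_translationNumber 0
    have h2 := hrot 0
    refine tendsto_nhds_unique h1 ?_
    refine h2.congr (fun m => ?_)
    rw [CircleDeg1Lift.coe_pow]; rfl
  rcases le_total i j with hij | hij
  · obtain ⟨d, rfl⟩ := Nat.exists_eq_add_of_le hij
    have h1 : ((k - l : ℤ) : ℝ) < (F ^ d).translationNumber := by
      rw [CircleDeg1Lift.translationNumber_pow, hτ]; push_cast at h ⊢; linarith
    have h2 := (F ^ d).lt_map_of_int_lt_translationNumber h1 (f^[i] x)
    rw [CircleDeg1Lift.coe_pow] at h2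
    have h3 : f^[i + d] x = F^[d] (f^[i] x) := by
      rw [add_comm, Function.iterate_add_apply]; rfl
    rw [h3]; push_cast at h2; linarith
  · obtain ⟨d, rfl⟩ := Nat.exists_eq_add_of_le hij
    have h1 : (F ^ d).translationNumber < ((l - k : ℤ) : ℝ) := by
      rw [CircleDeg1Lift.translationNumber_pow, hτ]; push_cast at h ⊢; linarith
    have h2 := (F ^ d).map_lt_of_translationNumber_lt_int h1 (f^[j] x)
    rw [CircleDeg1Lift.coe_pow] at h2
    have h3 : f^[j + d] x = F^[d] (f^[j] x) := by
      rw [add_comm, Function.iterate_add_apply]; rfl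
    rw [h3]; push_cast at h2; linarith

lemma orbit_le {f : ℝ → ℝ} (hper : ∀ x, f (x + 1) = f x + 1) (hm : StrictMono f) {α : ℝ}
    (hα : Irrational α)
    (hrot : ∀ x : ℝ, Tendsto (fun m : ℕ => (f^[m] x - x) / m) atTop (𝓝 α))
    (i j : ℕ) (k l : ℤ) (h : (i : ℝ) * α + k ≤ j * α + l) (x : ℝ) :
    f^[i] x + k ≤ f^[j] x + l := by
  rcases h.lt_or_eq with h | h
  · exact (orbit_lt hper hm hrot i j k l h x).le
  · by_cases hij : i = j
    · subst hij
      have : (k : ℝ) = l := by linarith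
      rw [this]
    · exfalso
      have hne : ((i : ℤ) - j) ≠ 0 := by omega
      have hI : Irrational ((((i : ℤ) - j : ℤ) : ℝ) * α - ((l - k : ℤ) : ℝ)) :=
        (hα.intCast_mul hne).sub_intCast _
      apply hI.ne_zero
      push_cast; linarith

lemma iter_comm_g {f g : ℝ → ℝ} {q : ℕ} {p : ℤ} (hper : ∀ x, f (x + 1) = f x + 1)
    (hm : StrictMono f) (hg : ∀ x, g x = f^[q] x - p) (i : ℕ) (x : ℝ) :
    g (f^[i] x) = f^[i + q] x - p ∧ f^[i] (g x) = f^[i + q] x - p := by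
  constructor
  · rw [hg, ← Function.iterate_add_apply, add_comm]
  · rw [hg]
    have := iter_add_int hper hm i (f^[q] x) (-p)
    push_cast at this
    rw [sub_eq_add_neg, this, ← Function.iterate_add_apply]; ring

/-- Disjointness: total length of the first `Q` images of `[x, g x]`. -/
lemma sum_le_one {f g : ℝ → ℝ} {α : ℝ} {q Q : ℕ} {p P : ℤ} (hper : ∀ x, f (x + 1) = f x + 1)
    (hm : StrictMono f) (hα : Irrational α)
    (hrot : ∀ x : ℝ, Tendsto (fun m : ℕ => (f^[m] x - x) / m) atTop (𝓝 α))
    (hg : ∀ x, g x = f^[q] x - p) (hc : CFPair α q Q p P) (hδ : 0 < (q : ℝ) * α - p) (x : ℝ) :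
    ∑ i ∈ Finset.range Q, (g (f^[i] x) - f^[i] x) ≤ 1 := by
  have ol := orbit_le hper hm hα hrot
  have hlt1 := hc.lt_one
  have hbest := hc.best
  rw [abs_of_pos hδ] at hlt1 hbest
  have hgi : ∀ i, g (f^[i] x) = f^[i + q] x - p := fun i => (iter_comm_g hper hm hg i x).1
  let k : ℕ → ℤ := fun i => -⌊(i : ℝ) * α⌋
  let A : ℕ → Set ℝ := fun i => Set.Ioc (f^[i] x + k i) (g (f^[i] x) + k i)
  have hk0 : ∀ i : ℕ, 0 ≤ (i : ℝ) * α + k i := fun i => by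
    have := Int.floor_le ((i : ℝ) * α); simp only [k]; push_cast; linarith
  have hk1 : ∀ i : ℕ, (i : ℝ) * α + k i < 1 := fun i => by
    have := Int.lt_floor_add_one ((i : ℝ) * α); simp only [k]; push_cast; linarith
  -- if two points differ, they differ by at least δ
  have gap : ∀ i j : ℕ, i < Q → j < Q → ∀ a b : ℤ, (i : ℝ) * α + a < j * α + b →
      ((i + q : ℕ) : ℝ) * α + (a - p : ℤ) ≤ j * α + b := by
    intro i j hi hj a b h
    push_cast
    rcases lt_trichotomy i j with hij | hij | hij
    · have := hbest (j - i) (by omega) (by omega) (a - b)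
      rw [Nat.cast_sub hij.le] at this
      push_cast at this
      rw [abs_of_pos (by linarith)] at this
      linarith
    · subst hij
      have : a < b := by
        have : (a : ℝ) < b := by linarith
        exact_mod_cast this
      have : (a : ℝ) + 1 ≤ b := by exact_mod_cast this
      linarith
    · have := hbest (i - j) (by omega) (by omega) (b - a)
      rw [Nat.cast_sub hij.le] at this
      push_cast at this
      rw [abs_of_neg (by linarith)] at this
      linarith
  have hdisj1 : ∀ i j : ℕ, i < Q → j < Q → (i : ℝ) * α + k i < j * α + k j →
      Disjoint (A i) (A j) := by
    intro i j hi hj h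
    have h1 := ol (i + q) j (k i - p) (k j) (gap i j hi hj _ _ h) x
    rw [Set.disjoint_left]
    intro z hz hz'
    simp only [A, Set.mem_Ioc, hgi] at hz hz'
    push_cast at h1
    linarith [hz.2, hz'.1]
  have hdisj : Set.PairwiseDisjoint (↑(Finset.range Q)) A := by
    intro i hi j hj hij
    have hi' : i < Q := by simpa using hi
    have hj' : j < Q := by simpa using hj
    rcases lt_trichotomy ((i : ℝ) * α + k i) (j * α + k j) with h | h | h
    · exact hdisj1 i j hi' hj' h
    · exfalso
      have hne : ((i : ℤ) - j) ≠ 0 := by omega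
      have hI : Irrational ((((i : ℤ) - j : ℤ) : ℝ) * α - ((k j - k i : ℤ) : ℝ)) :=
        (hα.intCast_mul hne).sub_intCast _
      apply hI.ne_zero
      push_cast; linarith
    · exact (hdisj1 j i hj' hi' h).symm
  have hsub : (⋃ i ∈ Finset.range Q, A i) ⊆ Set.Ioc x (x + 1) := by
    intro z hz
    simp only [Set.mem_iUnion, Finset.mem_range] at hz
    obtain ⟨i, hi, hz⟩ := hz
    have h1 := ol 0 i 0 (k i) (by push_cast; linarith [hk0 i]) x
    have h2 := ol (i + q) 0 (k i - p) 1
      (gap i 0 hi (by omega) _ _ (by push_cast; linarith [hk1 i])) x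
    simp only [A, Set.mem_Ioc, hgi] at hz
    simp only [Function.iterate_zero, id] at h1 h2
    push_cast at h1 h2
    constructor <;> linarith [hz.1, hz.2]
  have hmeas := MeasureTheory.measure_biUnion_finset (μ := MeasureTheory.volume) hdisj
    (fun i _ => measurableSet_Ioc)
  have hle := MeasureTheory.measure_mono (μ := MeasureTheory.volume) hsub
  rw [hmeas] at hle
  simp only [A, Real.volume_Ioc] at hle
  have hnn : ∀ i ∈ Finset.range Q, 0 ≤ g (f^[i] x) + k i - (f^[i] x + k i) := by
    intro i _
    have h1 := ol i (i + q) 0 (-p) (by push_cast; linarith) x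
    rw [hgi]; push_cast at h1; linarith
  rw [← ENNReal.ofReal_sum_of_nonneg hnn, ENNReal.ofReal_le_ofReal_iff (by linarith)] at hle
  calc _ = ∑ i ∈ Finset.range Q, (g (f^[i] x) + k i - (f^[i] x + k i)) := by
        apply Finset.sum_congr rfl; intros; ring
    _ ≤ _ := hle
    _ = 1 := by ring

/-- Covering. -/
lemma orbit_cover {f g : ℝ → ℝ} {α : ℝ} {q Q : ℕ} {p P : ℤ} (hper : ∀ x, f (x + 1) = f x + 1)
    (hm : StrictMono f) (hα : Irrational α)
    (hrot : ∀ x : ℝ, Tendsto (fun m : ℕ => (f^[m] x - x) / m) atTop (𝓝 α))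
    (hg : ∀ x, g x = f^[q] x - p) (hc : CFPair α q Q p P) (hδ : 0 < (q : ℝ) * α - p) (x y : ℝ) :
    ∃ j : ℕ, j ≤ Q + q ∧ ∃ k : ℤ, f^[j] x + k ≤ y ∧ y ≤ g (f^[j] x) + k := by
  have hδ' : (Q : ℝ) * α - P < 0 := by
    have := hc.opp; by_contra h; push Not at h; nlinarith
  have hle := hc.le
  rw [abs_of_pos hδ, abs_of_neg hδ'] at hle
  have hgi : ∀ i, g (f^[i] x) = f^[i + q] x - p := fun i => (iter_comm_g hper hm hg i x).1
  let κ : ℕ → ℤ := fun j => ⌊y - f^[j] x⌋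
  obtain ⟨j, hj, hmax⟩ := Finset.exists_max_image (Finset.range (Q + q + 1))
    (fun j => f^[j] x + κ j) ⟨0, by simp⟩
  have hj' : j ≤ Q + q := by simpa [Nat.lt_succ_iff] using hj
  have hPy : f^[j] x + κ j ≤ y := by
    have := Int.floor_le (y - f^[j] x); simp only [κ]; linarith
  have hbig : ∀ i : ℕ, i ≤ Q + q → ∀ k : ℤ, f^[j] x + κ j < f^[i] x + k → y < f^[i] x + k := by
    intro i hi k h
    by_contra hcon
    push Not at hcon
    have h1 : k ≤ κ i := by
      simp only [κ]; rw [Int.le_floor]; linarith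
    have h1' : (k : ℝ) ≤ κ i := by exact_mod_cast h1
    have h2 := hmax i (by simp; omega)
    linarith
  refine ⟨j, hj', κ j, hPy, ?_⟩
  rw [hgi]
  by_cases hcase : j + q ≤ Q + q
  · have h1 := orbit_lt hper hm hrot j (j + q) (κ j) (κ j - p) (by push_cast; linarith) x
    have h2 := hbig (j + q) hcase _ h1
    push_cast at h2; linarith
  · have hjQ : Q ≤ j := by omega
    have h1 := orbit_lt hper hm hrot j (j - Q) (κ j) (κ j + P)
      (by rw [Nat.cast_sub hjQ]; push_cast; linarith) x
    have h2 := hbig (j - Q) (by omega) _ h1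
    have h3 := orbit_le hper hm hα hrot (j - Q) (j + q) (κ j + P) (κ j - p)
      (by rw [Nat.cast_sub hjQ]; push_cast; linarith) x
    push_cast at h2 h3; linarith

/-! ### Cross-ratio distortion -/

/-- Averaged derivative, equal to the slope of `f` between `s` and `t`. -/
noncomputable def slp (f : ℝ → ℝ) (s t : ℝ) : ℝ := ∫ u in (0:ℝ)..1, deriv f (s + u * (t - s))

lemma slp_self (f : ℝ → ℝ) (s : ℝ) : slp f s s = deriv f s := by simp [slp]

lemma slp_mul {f : ℝ → ℝ} (hf : ContDiff ℝ 3 f) (s t : ℝ) :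
    slp f s t * (t - s) = f t - f s := by
  have hd : Differentiable ℝ f := hf.differentiable (by norm_num)
  have hc : Continuous (deriv f) := hf.continuous_deriv (by norm_num)
  have h : ∀ u ∈ Set.uIcc (0:ℝ) 1, HasDerivAt (fun u => f (s + u * (t - s)))
      (deriv f (s + u * (t - s)) * (t - s)) u := by
    intro u _
    have h1 : HasDerivAt (fun u : ℝ => s + u * (t - s)) (t - s) u := by
      simpa using ((hasDerivAt_id u).mul_const (t - s)).const_add s
    exact (hd (s + u * (t - s))).hasDerivAt.comp u h1
  have h2 := intervalIntegral.integral_eq_sub_of_hasDerivAt h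
    (by apply Continuous.intervalIntegrable; fun_prop)
  rw [intervalIntegral.integral_mul_const] at h2
  unfold slp
  rw [h2]; simp

/-- Constants controlling `f`. -/
structure Bds (f : ℝ → ℝ) (c C₁ C₂ C₃ : ℝ) : Prop where
  smooth : ContDiff ℝ 3 f
  cpos : 0 < c
  lower : ∀ x, c ≤ deriv f x
  upper : ∀ x, deriv f x ≤ C₁
  lip : ∀ x y, |deriv f x - deriv f y| ≤ C₂ * |x - y|
  lip2 : ∀ x v w, |deriv f (x + v + w) - deriv f (x + v) - deriv f (x + w) + deriv f x|
    ≤ C₃ * |v| * |w|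

namespace Bds
variable {f : ℝ → ℝ} {c C₁ C₂ C₃ : ℝ}

lemma cont (h : Bds f c C₁ C₂ C₃) : Continuous (deriv f) :=
  h.smooth.continuous_deriv (by norm_num)

lemma C₂_nonneg (h : Bds f c C₁ C₂ C₃) : 0 ≤ C₂ := by
  have := h.lip 0 1; simp at this; exact (abs_nonneg _).trans this

lemma C₃_nonneg (h : Bds f c C₁ C₂ C₃) : 0 ≤ C₃ := by
  have := h.lip2 0 1 1; simp at this; exact (abs_nonneg _).trans this

lemma C₁_pos (h : Bds f c C₁ C₂ C₃) : 0 < C₁ := h.cpos.trans_le ((h.lower 0).trans (h.upper 0))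

lemma int (h : Bds f c C₁ C₂ C₃) (s t : ℝ) :
    IntervalIntegrable (fun u => deriv f (s + u * (t - s))) MeasureTheory.volume 0 1 := by
  have := h.cont
  apply Continuous.intervalIntegrable; fun_prop

lemma slp_ge (h : Bds f c C₁ C₂ C₃) (s t : ℝ) : c ≤ slp f s t := by
  have : ∫ u in (0:ℝ)..1, c ≤ slp f s t :=
    intervalIntegral.integral_mono_on (by norm_num) (by simp) (h.int s t) (fun u _ => h.lower _)
  simpa using this

lemma slp_le (h : Bds f c C₁ C₂ C₃) (s t : ℝ) : slp f s t ≤ C₁ := by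
  have : slp f s t ≤ ∫ u in (0:ℝ)..1, C₁ :=
    intervalIntegral.integral_mono_on (by norm_num) (h.int s t) (by simp) (fun u _ => h.upper _)
  simpa using this

lemma slp_pos (h : Bds f c C₁ C₂ C₃) (s t : ℝ) : 0 < slp f s t := h.cpos.trans_le (h.slp_ge s t)

lemma slp_lip (h : Bds f c C₁ C₂ C₃) (s t s' t' D : ℝ) (hs : |s - s'| ≤ D) (ht : |t - t'| ≤ D) :
    |slp f s t - slp f s' t'| ≤ C₂ * D := by
  unfold slp
  rw [← intervalIntegral.integral_sub (h.int s t) (h.int s' t')]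
  have := intervalIntegral.norm_integral_le_of_norm_le_const (a := (0:ℝ)) (b := 1) (C := C₂ * D)
    (f := fun u => deriv f (s + u * (t - s)) - deriv f (s' + u * (t' - s'))) (by
      intro u hu
      rw [Set.uIoc_of_le (by norm_num)] at hu
      rw [Real.norm_eq_abs]
      refine (h.lip _ _).trans ?_
      gcongr
      · exact h.C₂_nonneg
      · have e : s + u * (t - s) - (s' + u * (t' - s')) = (1 - u) * (s - s') + u * (t - t') := by
          ring
        rw [e]
        refine (abs_add_le _ _).trans ?_
        rw [abs_mul, abs_mul, abs_of_nonneg (by linarith [hu.2] : 0 ≤ 1 - u),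
          abs_of_nonneg hu.1.le]
        nlinarith [hu.1, hu.2])
  simpa using this

lemma slp_mixed (h : Bds f c C₁ C₂ C₃) (a b c' d : ℝ) :
    |slp f a b - slp f a c' - slp f d b + slp f d c'| ≤ C₃ * |a - d| * |b - c'| := by
  unfold slp
  rw [← intervalIntegral.integral_sub (h.int a b) (h.int a c'),
    ← intervalIntegral.integral_sub ((h.int a b).sub (h.int a c')) (h.int d b),
    ← intervalIntegral.integral_add (((h.int a b).sub (h.int a c')).sub (h.int d b)) (h.int d c')]
  have := intervalIntegral.norm_integral_le_of_norm_le_const (a := (0:ℝ)) (b := 1)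
    (C := C₃ * |a - d| * |b - c'|)
    (f := fun u => deriv f (a + u * (b - a)) - deriv f (a + u * (c' - a)) -
      deriv f (d + u * (b - d)) + deriv f (d + u * (c' - d))) (by
      intro u hu
      rw [Set.uIoc_of_le (by norm_num)] at hu
      rw [Real.norm_eq_abs]
      have h1 := h.lip2 (d + u * (c' - d)) ((1 - u) * (a - d)) (u * (b - c'))
      have e1 : d + u * (c' - d) + (1 - u) * (a - d) + u * (b - c') = a + u * (b - a) := by ring
      have e2 : d + u * (c' - d) + (1 - u) * (a - d) = a + u * (c' - a) := by ring
      have e3 : d + u * (c' - d) + u * (b - c') = d + u * (b - d) := by ring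
      rw [e1, e2, e3] at h1
      refine h1.trans ?_
      rw [abs_mul, abs_mul, abs_of_nonneg (by linarith [hu.2] : 0 ≤ 1 - u),
          abs_of_nonneg hu.1.le]
      have := h.C₃_nonneg
      have : (1 - u) * |a - d| ≤ |a - d| := by nlinarith [hu.1, hu.2, abs_nonneg (a - d)]
      have : u * |b - c'| ≤ |b - c'| := by nlinarith [hu.1, hu.2, abs_nonneg (b - c')]
      have : 0 ≤ u * |b - c'| := by have := hu.1; positivity
      gcongr)
  simpa using this

lemma log_sub_le {x y c D : ℝ} (hc : 0 < c) (hx : c ≤ x) (hy : c ≤ y) (h : |x - y| ≤ D) :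
    |Real.log x - Real.log y| ≤ D / c := by
  have aux : ∀ x y : ℝ, c ≤ x → c ≤ y → |x - y| ≤ D → Real.log x - Real.log y ≤ D / c := by
    intro x y hx hy h
    have hx0 : 0 < x := hc.trans_le hx
    have hy0 : 0 < y := hc.trans_le hy
    rw [← Real.log_div hx0.ne' hy0.ne']
    refine (Real.log_le_sub_one_of_pos (by positivity)).trans ?_
    have : x / y - 1 = (x - y) / y := by field_simp
    rw [this]
    have h1 := (le_abs_self _).trans h
    have hD := (abs_nonneg _).trans h
    rw [div_le_div_iff₀ hy0 hc]
    nlinarith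
  rw [abs_le]
  constructor
  · have := aux y x hy hx (by rwa [abs_sub_comm]); linarith
  · exact aux x y hx hy h

/-- Distortion for neighbouring slopes. -/
lemma log_slp_lip (h : Bds f c C₁ C₂ C₃) (s t s' t' D : ℝ) (hs : |s - s'| ≤ D)
    (ht : |t - t'| ≤ D) :
    |Real.log (slp f s t) - Real.log (slp f s' t')| ≤ C₂ / c * D := by
  have := log_sub_le h.cpos (h.slp_ge s t) (h.slp_ge s' t') (h.slp_lip s t s' t' D hs ht)
  rwa [mul_div_right_comm] at this

/-- Cross-ratio distortion. -/
lemma log_slp_mixed (h : Bds f c C₁ C₂ C₃) (a b c' d D : ℝ) (had : |a - d| ≤ D)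
    (hbc : |b - c'| ≤ D) :
    |Real.log (slp f a b) + Real.log (slp f d c') - Real.log (slp f a c') -
      Real.log (slp f d b)| ≤ (C₁ * C₃ + C₂ ^ 2) / c ^ 2 * D ^ 2 := by
  have hD : 0 ≤ D := (abs_nonneg _).trans had
  set A := slp f a b with hA
  set B := slp f a c' with hB
  set E := slp f d b with hE
  set F := slp f d c' with hF
  have hA0 := h.slp_pos a b
  have hB0 := h.slp_pos a c'
  have hE0 := h.slp_pos d b
  have hF0 := h.slp_pos d c'
  have hmix : |A - B - E + F| ≤ C₃ * D * D := by
    refine (h.slp_mixed a b c' d).trans ?_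
    have := h.C₃_nonneg
    gcongr
  have h1 : |A - B| ≤ C₂ * D := h.slp_lip a b a c' D (by simpa using hD) hbc
  have h2 : |A - E| ≤ C₂ * D := h.slp_lip a b d b D had (by simpa using hD)
  have key : |A * F - B * E| ≤ (C₁ * C₃ + C₂ ^ 2) * D ^ 2 := by
    have e : A * F - B * E = A * (A - B - E + F) - (A - B) * (A - E) := by ring
    rw [e]
    refine (abs_sub _ _).trans ?_
    rw [abs_mul, abs_mul, abs_of_pos hA0]
    have h3 : A * |A - B - E + F| ≤ C₁ * (C₃ * D * D) :=
      mul_le_mul (h.slp_le a b) hmix (abs_nonneg _) h.C₁_pos.le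
    have h4 : |A - B| * |A - E| ≤ (C₂ * D) * (C₂ * D) :=
      mul_le_mul h1 h2 (abs_nonneg _) ((abs_nonneg _).trans h1)
    nlinarith
  have hc := h.cpos
  have hAF : c ^ 2 ≤ A * F := by
    have := mul_le_mul (h.slp_ge a b) (h.slp_ge d c') hc.le hA0.le
    simpa [sq] using this
  have hBE : c ^ 2 ≤ B * E := by
    have := mul_le_mul (h.slp_ge a c') (h.slp_ge d b) hc.le hB0.le
    simpa [sq] using this
  have := log_sub_le (by positivity) hAF hBE key
  rw [Real.log_mul hA0.ne' hF0.ne', Real.log_mul hB0.ne' hE0.ne', mul_div_right_comm] at this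
  rw [show Real.log A + Real.log F - Real.log B - Real.log E =
    Real.log A + Real.log F - (Real.log B + Real.log E) by ring]
  exact this

end Bds

lemma periodic_bdd {φ : ℝ → ℝ} (hp : Function.Periodic φ 1) (hc : Continuous φ) :
    (∃ x, ∀ y, φ y ≤ φ x) ∧ (∃ x, ∀ y, φ x ≤ φ y) := by
  have hK := hp.compact_of_continuous one_ne_zero hc
  constructor
  · obtain ⟨z, ⟨x, rfl⟩, hx⟩ := hK.exists_isGreatest ⟨φ 0, 0, rfl⟩
    exact ⟨x, fun y => hx ⟨y, rfl⟩⟩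
  · obtain ⟨z, ⟨x, rfl⟩, hx⟩ := hK.exists_isLeast ⟨φ 0, 0, rfl⟩
    exact ⟨x, fun y => hx ⟨y, rfl⟩⟩

lemma periodic_abs_bdd {φ : ℝ → ℝ} (hp : Function.Periodic φ 1) (hc : Continuous φ) :
    ∃ C, ∀ y, |φ y| ≤ C := by
  obtain ⟨⟨x, hx⟩, _⟩ := periodic_bdd (φ := fun y => |φ y|) (fun y => by simp [hp y]) hc.abs
  exact ⟨_, hx⟩

lemma periodic_deriv {φ : ℝ → ℝ} (hp : ∀ x, deriv φ (x + 1) = deriv φ x) :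
    Function.Periodic (deriv (deriv φ)) 1 := by
  intro x
  rw [← deriv_comp_add_const]
  congr 1
  funext y
  exact hp y

lemma lip_of_deriv {φ : ℝ → ℝ} {C : ℝ} (hd : Differentiable ℝ φ) (hC : ∀ x, |deriv φ x| ≤ C)
    (x y : ℝ) : |φ x - φ y| ≤ C * |x - y| := by
  have := Convex.norm_image_sub_le_of_norm_deriv_le (f := φ) (s := Set.univ) (C := C)
    (fun x _ => hd x) (fun x _ => hC x) convex_univ (Set.mem_univ y) (Set.mem_univ x)
  simpa using this

lemma exists_bds {f : ℝ → ℝ} (hf : ContDiff ℝ 3 f) (hder : ∀ x, 0 < deriv f x)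
    (hper : ∀ x, f (x + 1) = f x + 1) : ∃ c C₁ C₂ C₃, Bds f c C₁ C₂ C₃ := by
  have hf2 : ContDiff ℝ 2 (deriv f) := by
    have := (contDiff_succ_iff_deriv (n := 2) (f := f) (𝕜 := ℝ)).1 (hf.of_le two_add_one_eq_three.le)
    exact this.2.2
  have hf1 : ContDiff ℝ 1 (deriv (deriv f)) := by
    have := (contDiff_succ_iff_deriv (n := 1) (f := deriv f) (𝕜 := ℝ)).1 (hf2.of_le one_add_one_eq_two.le)
    exact this.2.2
  have hp1 : Function.Periodic (deriv f) 1 := by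
    intro x
    rw [← deriv_comp_add_const]
    have : (fun x => f (x + 1)) = fun x => f x + 1 := funext hper
    rw [this, deriv_add_const]
  have hp2 := periodic_deriv hp1
  have hp3 := periodic_deriv hp2
  obtain ⟨⟨xM, hM⟩, ⟨xm, hmn⟩⟩ := periodic_bdd hp1 hf2.continuous
  obtain ⟨C₂, hC₂⟩ := periodic_abs_bdd hp2 hf1.continuous
  obtain ⟨C₃, hC₃⟩ := periodic_abs_bdd hp3 (hf1.continuous_deriv (by norm_num))
  have hd1 : Differentiable ℝ (deriv f) := hf2.differentiable (by norm_num)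
  have hd2 : Differentiable ℝ (deriv (deriv f)) := hf1.differentiable (by norm_num)
  refine ⟨deriv f xm, deriv f xM, C₂, C₃, hf, hder _, hmn, hM, lip_of_deriv hd1 hC₂, ?_⟩
  intro x v w
  have h := lip_of_deriv (φ := fun x => deriv f (x + v) - deriv f x) (C := C₃ * |v|)
    (by fun_prop) (by
      intro x
      have h1 : deriv (fun x => deriv f (x + v) - deriv f x) x =
          deriv (deriv f) (x + v) - deriv (deriv f) x := by
        rw [deriv_fun_sub (by fun_prop) (by fun_prop), deriv_comp_add_const]
      rw [h1]
      have := lip_of_deriv hd2 hC₃ (x + v) x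
      simpa using this) (x + w) x
  simp only [add_sub_cancel_left] at h
  rw [show x + v + w = x + w + v by ring]
  refine le_trans (le_of_eq ?_) h
  congr 1; ring

/-! ### The renormalized return map -/

/-- All data on the return map `g = f^q - p` used below. -/
structure Dat (f g : ℝ → ℝ) (q Q : ℕ) (p : ℤ) (M K V : ℝ) : Prop where
  smooth : ContDiff ℝ 3 f
  mono : StrictMono f
  per : ∀ x, f (x + 1) = f x + 1
  slpos : ∀ s t, 0 < slp f s t
  lip : ∀ s t s' t' D, |s - s'| ≤ D → |t - t'| ≤ D →
    |Real.log (slp f s t) - Real.log (slp f s' t')| ≤ V * D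
  mix : ∀ a b c d D, |a - d| ≤ D → |b - c| ≤ D →
    |Real.log (slp f a b) + Real.log (slp f d c) - Real.log (slp f a c) -
      Real.log (slp f d b)| ≤ K * D ^ 2
  Vn : 0 ≤ V
  Kn : 0 ≤ K
  hg : ∀ x, g x = f^[q] x - p
  pos : ∀ x, x < g x
  surj : Function.Surjective g
  qQ : q ≤ Q
  leM : ∀ x, g x - x ≤ M
  maxM : ∃ Y, g Y - Y = M
  M1 : M ≤ 1
  sum : ∀ x, ∑ i ∈ Finset.range Q, (g (f^[i] x) - f^[i] x) ≤ 1
  cov : ∀ x y, ∃ j : ℕ, j ≤ Q + q ∧ ∃ k : ℤ, f^[j] x + k ≤ y ∧ y ≤ g (f^[j] x) + k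

/-- Logarithm of the slope of `f^l`. -/
noncomputable def Gl (f : ℝ → ℝ) (l : ℕ) (s t : ℝ) : ℝ :=
  ∑ i ∈ Finset.range l, Real.log (slp f (f^[i] s) (f^[i] t))

/-- Logarithm of the ratio of consecutive steps. -/
noncomputable def lr (g : ℝ → ℝ) (x : ℝ) : ℝ :=
  Real.log (g (g x) - g x) - Real.log (g x - x)

/-- Logarithm of the cross-ratio of four consecutive points. -/
noncomputable def lk (g : ℝ → ℝ) (x : ℝ) : ℝ :=
  Real.log (g x - x) + Real.log (g (g (g x)) - g (g x)) - Real.log (g (g x) - x) -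
    Real.log (g (g (g x)) - g x)

lemma log_sub_comm (x y : ℝ) : Real.log (x - y) = Real.log (y - x) := by
  rw [← Real.log_neg_eq_log, neg_sub]

namespace Dat
variable {f g : ℝ → ℝ} {q Q : ℕ} {p : ℤ} {M K V : ℝ}

lemma comm (h : Dat f g q Q p M K V) (i : ℕ) (x : ℝ) : f^[i] (g x) = g (f^[i] x) := by
  have := iter_comm_g h.per h.mono h.hg i x
  rw [this.1, this.2]

lemma gmono (h : Dat f g q Q p M K V) : StrictMono g := by
  intro x y hxy
  rw [h.hg, h.hg]
  have := h.mono.iterate q hxy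
  linarith

lemma Mpos (h : Dat f g q Q p M K V) : 0 < M := by
  have := h.pos 0; have := h.leM 0; linarith

lemma g_int (h : Dat f g q Q p M K V) (x : ℝ) (k : ℤ) : g (x + k) = g x + k := by
  rw [h.hg, h.hg, iter_add_int h.per h.mono]; ring

lemma sum4 (h : Dat f g q Q p M K V) (l : ℕ) (hl : l ≤ 4 * Q) (x : ℝ) :
    ∑ i ∈ Finset.range l, (g (f^[i] x) - f^[i] x) ≤ 4 := by
  have step : ∀ n : ℕ, ∑ i ∈ Finset.range (n * Q), (g (f^[i] x) - f^[i] x) ≤ n := by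
    intro n
    induction n with
    | zero => simp
    | succ n ih =>
      rw [Nat.succ_mul, Finset.sum_range_add]
      have := h.sum (f^[n * Q] x)
      have e : ∀ i, f^[n * Q + i] x = f^[i] (f^[n * Q] x) := fun i => by
        rw [add_comm, Function.iterate_add_apply]
      simp only [e]
      push_cast
      linarith
  have h4 := step 4
  refine le_trans (Finset.sum_le_sum_of_subset_of_nonneg (Finset.range_mono hl) ?_) h4
  intro i _ _
  linarith [h.pos (f^[i] x)]

lemma Gl_ne (h : Dat f g q Q p M K V) (l : ℕ) {s t : ℝ} (hst : s ≠ t) :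
    Gl f l s t = Real.log (f^[l] t - f^[l] s) - Real.log (t - s) := by
  induction l with
  | zero => simp [Gl]
  | succ l ih =>
    have hne : f^[l] t - f^[l] s ≠ 0 := by
      rw [sub_ne_zero]; exact fun e => hst ((h.mono.iterate l).injective e).symm
    have e : Gl f (l + 1) s t = Gl f l s t + Real.log (slp f (f^[l] s) (f^[l] t)) := by
      simp [Gl, Finset.sum_range_succ]
    rw [e, ih, Function.iterate_succ_apply', Function.iterate_succ_apply',
      ← slp_mul h.smooth (f^[l] s) (f^[l] t), Real.log_mul (h.slpos _ _).ne' hne]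
    ring

lemma hasDeriv_iter (h : Dat f g q Q p M K V) (l : ℕ) (s : ℝ) :
    HasDerivAt f^[l] (Real.exp (Gl f l s s)) s := by
  induction l with
  | zero => simpa [Gl] using hasDerivAt_id s
  | succ l ih =>
    have e : Gl f (l + 1) s s = Gl f l s s + Real.log (slp f (f^[l] s) (f^[l] s)) := by
      simp [Gl, Finset.sum_range_succ]
    have hd : Differentiable ℝ f := h.smooth.differentiable (by norm_num)
    have h1 := (hd (f^[l] s)).hasDerivAt.comp s ih
    rw [e, Real.exp_add, Real.exp_log (h.slpos _ _), slp_self, mul_comm, Function.iterate_succ']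
    exact h1

lemma hasDeriv_g (h : Dat f g q Q p M K V) (s : ℝ) :
    HasDerivAt g (Real.exp (Gl f q s s)) s := by
  have : g = fun x => f^[q] x - p := funext h.hg
  rw [this]
  exact (h.hasDeriv_iter q s).sub_const _

lemma abs_iter (h : Dat f g q Q p M K V) (i : ℕ) {x y a b : ℝ} (ha : a ∈ Set.Icc x y)
    (hb : b ∈ Set.Icc x y) : |f^[i] a - f^[i] b| ≤ f^[i] y - f^[i] x := by
  have hm := (h.mono.iterate i).monotone
  rw [abs_le]
  constructor <;> linarith [hm ha.1, hm ha.2, hm hb.1, hm hb.2]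

lemma mixG (h : Dat f g q Q p M K V) (l : ℕ) (hl : l ≤ 4 * Q) {x a b c d : ℝ}
    (ha : a ∈ Set.Icc x (g (g (g x)))) (hb : b ∈ Set.Icc x (g (g (g x))))
    (hc : c ∈ Set.Icc x (g (g (g x)))) (hd : d ∈ Set.Icc x (g (g (g x)))) :
    |Gl f l a b + Gl f l d c - Gl f l a c - Gl f l d b| ≤ 36 * K * M := by
  have e : Gl f l a b + Gl f l d c - Gl f l a c - Gl f l d b =
      ∑ i ∈ Finset.range l, (Real.log (slp f (f^[i] a) (f^[i] b)) +
        Real.log (slp f (f^[i] d) (f^[i] c)) - Real.log (slp f (f^[i] a) (f^[i] c)) -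
        Real.log (slp f (f^[i] d) (f^[i] b))) := by
    simp only [Gl, Finset.sum_sub_distrib, Finset.sum_add_distrib]
  rw [e]
  refine (Finset.abs_sum_le_sum_abs _ _).trans ?_
  have hK := h.Kn
  have hM := h.Mpos
  have hD : ∀ i, f^[i] (g (g (g x))) - f^[i] x = (g (f^[i] x) - f^[i] x) +
      (g (f^[i] (g x)) - f^[i] (g x)) + (g (f^[i] (g (g x))) - f^[i] (g (g x))) := by
    intro i
    simp only [h.comm]; ring
  calc _ ≤ ∑ i ∈ Finset.range l, K * (3 * M) * ((g (f^[i] x) - f^[i] x) +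
      (g (f^[i] (g x)) - f^[i] (g x)) + (g (f^[i] (g (g x))) - f^[i] (g (g x)))) := by
        apply Finset.sum_le_sum
        intro i _
        refine (h.mix _ _ _ _ _ (h.abs_iter i ha hd) (h.abs_iter i hb hc)).trans ?_
        rw [hD i, mul_assoc]
        have h1 := h.leM (f^[i] x)
        have h2 := h.leM (f^[i] (g x))
        have h3 := h.leM (f^[i] (g (g x)))
        have h1' := h.pos (f^[i] x)
        have h2' := h.pos (f^[i] (g x))
        have h3' := h.pos (f^[i] (g (g x)))
        rw [sq]
        gcongr
        · linarith
    _ ≤ _ := by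
        rw [← Finset.mul_sum, Finset.sum_add_distrib, Finset.sum_add_distrib]
        have h1 := h.sum4 l hl x
        have h2 := h.sum4 l hl (g x)
        have h3 := h.sum4 l hl (g (g x))
        have : 0 ≤ K * (3 * M) := by positivity
        nlinarith

lemma lipG (h : Dat f g q Q p M K V) (l : ℕ) (hl : l ≤ 4 * Q) (x : ℝ) :
    |Gl f l (g x) (g (g x)) - Gl f l x (g x)| ≤ 8 * V := by
  have e : Gl f l (g x) (g (g x)) - Gl f l x (g x) =
      ∑ i ∈ Finset.range l, (Real.log (slp f (f^[i] (g x)) (f^[i] (g (g x)))) -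
        Real.log (slp f (f^[i] x) (f^[i] (g x)))) := by
    simp only [Gl, Finset.sum_sub_distrib]
  rw [e]
  refine (Finset.abs_sum_le_sum_abs _ _).trans ?_
  have hV := h.Vn
  have p1 := (h.pos x).le
  have p2 := (h.pos (g x)).le
  calc _ ≤ ∑ i ∈ Finset.range l, V * ((g (f^[i] x) - f^[i] x) +
      (g (f^[i] (g x)) - f^[i] (g x))) := by
        apply Finset.sum_le_sum
        intro i _
        have hD : f^[i] (g (g x)) - f^[i] x = (g (f^[i] x) - f^[i] x) +
          (g (f^[i] (g x)) - f^[i] (g x)) := by simp only [h.comm]; ring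
        rw [← hD]
        exact h.lip _ _ _ _ _ (h.abs_iter i ⟨p1, p2⟩ ⟨le_rfl, p1.trans p2⟩)
          (h.abs_iter i ⟨p1.trans p2, le_rfl⟩ ⟨p1, p2⟩)
    _ ≤ _ := by
        rw [← Finset.mul_sum, Finset.sum_add_distrib]
        have h1 := h.sum4 l hl x
        have h2 := h.sum4 l hl (g x)
        nlinarith

lemma lr_iter (h : Dat f g q Q p M K V) (l : ℕ) (hl : l ≤ 4 * Q) (x : ℝ) :
    |lr g (f^[l] x) - lr g x| ≤ 8 * V := by
  have := h.lipG l hl x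
  rw [h.Gl_ne l (h.pos x).ne, h.Gl_ne l (h.pos (g x)).ne] at this
  simp only [h.comm] at this
  unfold lr
  convert this using 2
  ring

lemma lr_int (h : Dat f g q Q p M K V) (x : ℝ) (k : ℤ) : lr g (x + k) = lr g x := by
  simp only [lr, h.g_int]
  congr 2 <;> ring

lemma lk_int (h : Dat f g q Q p M K V) (x : ℝ) (k : ℤ) : lk g (x + k) = lk g x := by
  simp only [lk, h.g_int]
  congr 1
  · congr 1
    · congr 2 <;> ring
    · congr 1; ring
  · congr 1; ring

lemma lk_iter (h : Dat f g q Q p M K V) (l : ℕ) (hl : l ≤ 4 * Q) (x : ℝ) :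
    |lk g (f^[l] x) - lk g x| ≤ 36 * K * M := by
  have p1 := h.pos x
  have p2 := h.pos (g x)
  have p3 := h.pos (g (g x))
  have := h.mixG l hl (x := x) (a := x) (b := g x) (c := g (g x)) (d := g (g (g x)))
    ⟨by linarith, by linarith⟩ ⟨by linarith, by linarith⟩ ⟨by linarith, by linarith⟩
    ⟨by linarith, by linarith⟩
  rw [h.Gl_ne l p1.ne, h.Gl_ne l p3.ne', h.Gl_ne l (p1.trans p2).ne,
    h.Gl_ne l (p2.trans p3).ne'] at this
  simp only [h.comm] at this
  rw [log_sub_comm (g (g (f^[l] x))) (g (g (g (f^[l] x)))), log_sub_comm (g (g x)) (g (g (g x))),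
    log_sub_comm (g x) (g (g (g x))), log_sub_comm (g (f^[l] x)) (g (g (g (f^[l] x))))] at this
  unfold lk
  convert this using 2
  ring

/-- Denjoy-type a priori bound. -/
lemma lr_bdd (h : Dat f g q Q p M K V) (x : ℝ) : |lr g x| ≤ Real.log 2 + 8 * V := by
  obtain ⟨Y, hY⟩ := h.maxM
  obtain ⟨j, hj, k, h1, h2⟩ := h.cov (g x) Y
  have hqQ := h.qQ
  -- points `w₀ = f^j x`, `g w₀`, `g (g w₀)`
  set w := f^[j] x + k with hw
  have hgw : f^[j] (g x) + k = g w := by rw [hw, h.g_int, h.comm]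
  have hggw : g (f^[j] (g x)) + k = g (g w) := by rw [← hgw, h.g_int]
  rw [hgw] at h1
  rw [hggw] at h2
  have hgY : g Y ≤ g (g (g w)) := h.gmono.monotone h2
  have hit : ∀ i : ℕ, ∃ r : ℤ, g^[i] w = f^[j + i * q] x + r := by
    intro i
    induction i with
    | zero => exact ⟨k, by simp [hw]⟩
    | succ i ih =>
      obtain ⟨r, hr⟩ := ih
      refine ⟨r - p, ?_⟩
      rw [Function.iterate_succ_apply', hr, h.g_int, h.hg, ← Function.iterate_add_apply]
      push_cast
      rw [show q + (j + i * q) = j + (i + 1) * q by ring]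
      ring
  have hlr : ∀ i : ℕ, i ≤ 2 → |lr g (g^[i] w) - lr g x| ≤ 8 * V := by
    intro i hi
    obtain ⟨r, hr⟩ := hit i
    rw [hr, h.lr_int]
    exact h.lr_iter _ (by nlinarith) x
  have l0 := hlr 0 (by norm_num)
  have l1 := hlr 1 (by norm_num)
  have l2 := hlr 2 (by norm_num)
  simp only [Function.iterate_succ, Function.iterate_zero, Function.comp, id] at l0 l1 l2
  -- if `m(g v) ≥ M/2` then `lr v ≥ - log 2` and `lr (g v) ≤ log 2`
  have key : ∀ v, M / 2 ≤ g (g v) - g v → -Real.log 2 ≤ lr g v ∧ lr g (g v) ≤ Real.log 2 := by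
    intro v hv
    have hp0 := h.pos v
    have hp1 := h.pos (g v)
    have hp2 := h.pos (g (g v))
    have hM0 := h.leM v
    have hM2 := h.leM (g (g v))
    constructor
    · have : Real.log (g v - v) ≤ Real.log (2 * (g (g v) - g v)) :=
        Real.log_le_log (by linarith) (by linarith)
      rw [Real.log_mul (by norm_num) (by linarith)] at this
      unfold lr; linarith
    · have : Real.log (g (g (g v)) - g (g v)) ≤ Real.log (2 * (g (g v) - g v)) :=
        Real.log_le_log (by linarith) (by linarith)
      rw [Real.log_mul (by norm_num) (by linarith)] at this
      unfold lr; linarith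
  have hor : M / 2 ≤ g (g w) - g w ∨ M / 2 ≤ g (g (g w)) - g (g w) := by
    by_contra hcon
    push Not at hcon
    linarith
  rw [abs_le] at *
  rcases hor with hc | hc
  · have := key w hc
    constructor <;> linarith [this.1, this.2, l0.1, l0.2, l1.1, l1.2]
  · have := key (g w) hc
    constructor <;> linarith [this.1, this.2, l2.1, l2.2, l1.1, l1.2]

end Dat

/-! ### Real inequalities -/

lemma abs_exp_sub_one (e T : ℝ) (h : |e| ≤ T) : |Real.exp e - 1| ≤ T * Real.exp T := by
  have hT : 0 ≤ T := (abs_nonneg _).trans h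
  have h1 : e ≤ T := (le_abs_self _).trans h
  have h2 : -T ≤ e := (abs_le.1 h).1
  have h3 := Real.one_le_exp hT
  rw [abs_le]
  constructor
  · have := Real.add_one_le_exp e
    nlinarith
  · have h4 : Real.exp e ≤ Real.exp T := Real.exp_le_exp.2 h1
    have h5 := Real.add_one_le_exp (-T)
    have h6 : Real.exp T * Real.exp (-T) = 1 := by rw [← Real.exp_add]; simp
    nlinarith [Real.exp_pos T]

/-- The algebraic heart: cancellation in the derivative of the cross-ratio. -/
lemma deriv_alg {a b c R η x₁ x₂ x₃ : ℝ} (ha : 0 < a) (hb : 0 < b) (hc : 0 < c)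
    (hba : b ≤ R * a) (hbc : b ≤ R * c) (hcb : c ≤ R * b)
    (h1 : |x₁ - 1| ≤ η) (h2 : |x₂ - 1| ≤ η) (h3 : |x₃ - 1| ≤ η) :
    |(x₁ * (b ^ 2 * (b + c) / (a * c * (a + b))) - 1) / a +
      (x₃ * (c * (b + c) / (a * (a + b))) - x₂ * (b ^ 2 / a ^ 2)) / c -
      (x₂ * (b ^ 2 / a ^ 2) - 1) / (a + b) -
      (x₃ * (c * (b + c) / (a * (a + b))) - x₁ * (b ^ 2 * (b + c) / (a * c * (a + b)))) / (b + c)|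
      ≤ (2 * (R ^ 2 * (1 + R)) + 1) * η / a := by
  have hη : 0 ≤ η := (abs_nonneg _).trans h1
  have hR : 0 < R := by
    by_contra hcon; push Not at hcon; nlinarith
  set T := b ^ 2 * (a + b + c) / (a ^ 2 * c * (a + b)) with hT
  set U := b / (a * (a + b)) with hU
  have hT0 : 0 ≤ T := by positivity
  have hU0 : 0 ≤ U := by positivity
  have e : (x₁ * (b ^ 2 * (b + c) / (a * c * (a + b))) - 1) / a +
      (x₃ * (c * (b + c) / (a * (a + b))) - x₂ * (b ^ 2 / a ^ 2)) / c -
      (x₂ * (b ^ 2 / a ^ 2) - 1) / (a + b) -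
      (x₃ * (c * (b + c) / (a * (a + b))) - x₁ * (b ^ 2 * (b + c) / (a * c * (a + b)))) / (b + c)
      = T * (x₁ - 1) - T * (x₂ - 1) + U * (x₃ - 1) := by
    rw [hT, hU]; field_simp; ring
  rw [e]
  have hTb : T ≤ R ^ 2 * (1 + R) / a := by
    have e1 : T = (b / a) * (b / c) * ((a + b + c) / (a + b)) / a := by
      rw [hT]; field_simp
    rw [e1]
    have i1 : b / a ≤ R := by rw [div_le_iff₀ ha]; exact hba
    have i2 : b / c ≤ R := by rw [div_le_iff₀ hc]; exact hbc
    have i3 : (a + b + c) / (a + b) ≤ 1 + R := by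
      rw [div_le_iff₀ (by positivity)]; nlinarith
    have : (b / a) * (b / c) * ((a + b + c) / (a + b)) ≤ R * R * (1 + R) := by gcongr
    rw [sq]
    gcongr
  have hUb : U ≤ 1 / a := by
    rw [hU, div_le_div_iff₀ (by positivity) ha]; nlinarith
  calc |T * (x₁ - 1) - T * (x₂ - 1) + U * (x₃ - 1)|
      ≤ |T * (x₁ - 1)| + |T * (x₂ - 1)| + |U * (x₃ - 1)| :=
        (abs_add_le _ _).trans (add_le_add (abs_sub _ _) le_rfl)
    _ = T * |x₁ - 1| + T * |x₂ - 1| + U * |x₃ - 1| := by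
        rw [abs_mul, abs_mul, abs_mul, abs_of_nonneg hT0, abs_of_nonneg hU0]
    _ ≤ (R ^ 2 * (1 + R) / a) * η + (R ^ 2 * (1 + R) / a) * η + (1 / a) * η := by gcongr
    _ = _ := by ring

/-- If `κ ≤ r/(1+r)²` is close to `1/4` then `r` is close to `1`. -/
lemma sq_bound {r w : ℝ} (hr : 0 < r) (h : Real.log (1 / 4) - w ≤ Real.log (r / (1 + r) ^ 2)) :
    (r - 1) ^ 2 ≤ w * (1 + r) ^ 2 := by
  have h1 : Real.exp (-w) ≤ 4 * (r / (1 + r) ^ 2) := by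
    rw [← Real.exp_log (show 0 < 4 * (r / (1 + r) ^ 2) by positivity)]
    apply Real.exp_le_exp.2
    rw [Real.log_mul (by norm_num) (by positivity)]
    rw [one_div, Real.log_inv] at h
    linarith
  have h2 := Real.add_one_le_exp (-w)
  have h3 : 1 - w ≤ 4 * r / (1 + r) ^ 2 := by rw [mul_div_assoc]; linarith
  rw [le_div_iff₀ (by positivity)] at h3
  nlinarith

lemma log_upper {r w R : ℝ} (hr : 0 < r) (hrR : r ≤ R) (hw : 0 ≤ w)
    (h : (r - 1) ^ 2 ≤ w * (1 + r) ^ 2) : Real.log r ≤ (1 + R) * Real.sqrt w := by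
  have h1 : |r - 1| ≤ Real.sqrt w * (1 + r) := by
    apply abs_le_of_sq_le_sq _ (by positivity)
    rw [mul_pow, Real.sq_sqrt hw]; exact h
  have h2 := Real.log_le_sub_one_of_pos hr
  have h3 := le_abs_self (r - 1)
  have := Real.sqrt_nonneg w
  nlinarith

lemma log_lower {r w R : ℝ} (hr : 0 < r) (hrR : 1 ≤ R * r) (hw : 0 ≤ w)
    (h : (r - 1) ^ 2 ≤ w * (1 + r) ^ 2) : -((1 + R) * Real.sqrt w) ≤ Real.log r := by
  have h1 : (r⁻¹ - 1) ^ 2 ≤ w * (1 + r⁻¹) ^ 2 := by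
    have e1 : (r⁻¹ - 1) ^ 2 = (r - 1) ^ 2 / r ^ 2 := by field_simp; ring
    have e2 : w * (1 + r⁻¹) ^ 2 = w * (1 + r) ^ 2 / r ^ 2 := by field_simp; ring
    rw [e1, e2]; gcongr
  have := log_upper (r := r⁻¹) (R := R) (by positivity)
    (by rw [inv_le_iff_one_le_mul₀ hr]; exact hrR) hw h1
  rw [Real.log_inv] at this
  linarith

/-- Cross-ratio in terms of ratios. -/
lemma kappa_le {a b c : ℝ} (ha : 0 < a) (hb : 0 < b) (hc : 0 < c) (h : c / b ≤ b / a) :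
    Real.log a + Real.log c - Real.log (a + b) - Real.log (b + c) ≤
      Real.log ((b / a) / (1 + b / a) ^ 2) ∧
    Real.log a + Real.log c - Real.log (a + b) - Real.log (b + c) ≤
      Real.log ((c / b) / (1 + c / b) ^ 2) := by
  have e : Real.log a + Real.log c - Real.log (a + b) - Real.log (b + c) =
      Real.log (a * c / ((a + b) * (b + c))) := by
    rw [Real.log_div (by positivity) (by positivity), Real.log_mul (by positivity) (by positivity),
      Real.log_mul (by positivity) (by positivity)]
    ring
  have hac : a * c ≤ b * b := by
    rw [div_le_div_iff₀ hb ha] at h; linarith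
  rw [e]
  constructor
  · apply Real.log_le_log (by positivity)
    have : (b / a) / (1 + b / a) ^ 2 = a * b / (a + b) ^ 2 := by field_simp
    rw [this, div_le_div_iff₀ (by positivity) (by positivity)]
    have : 0 ≤ a * (a + b) * (b * (b + c) - c * (a + b)) := by
      have : 0 ≤ b * (b + c) - c * (a + b) := by nlinarith
      positivity
    nlinarith
  · apply Real.log_le_log (by positivity)
    have : (c / b) / (1 + c / b) ^ 2 = c * b / (b + c) ^ 2 := by field_simp
    rw [this, div_le_div_iff₀ (by positivity) (by positivity)]
    have : 0 ≤ c * (b + c) * (b * (a + b) - a * (b + c)) := by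
      have : 0 ≤ b * (a + b) - a * (b + c) := by nlinarith
      positivity
    nlinarith

lemma kappa_ge {a b c : ℝ} (hb : 0 < b) (hab : b ≤ a) (hbc : b ≤ c) :
    Real.log (1 / 4) ≤ Real.log a + Real.log c - Real.log (a + b) - Real.log (b + c) := by
  have ha : 0 < a := by linarith
  have hc : 0 < c := by linarith
  have e : Real.log a + Real.log c - Real.log (a + b) - Real.log (b + c) =
      Real.log (a * c / ((a + b) * (b + c))) := by
    rw [Real.log_div (by positivity) (by positivity), Real.log_mul (by positivity) (by positivity),
      Real.log_mul (by positivity) (by positivity)]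
    ring
  rw [e]
  apply Real.log_le_log (by norm_num)
  rw [div_le_div_iff₀ (by positivity) (by positivity)]
  nlinarith [mul_nonneg (sub_nonneg.2 hab) (sub_nonneg.2 hbc)]

namespace Dat
variable {f g : ℝ → ℝ} {q Q : ℕ} {p : ℤ} {M K V : ℝ}

lemma Gl_g (h : Dat f g q Q p M K V) {s t : ℝ} (hst : s ≠ t) :
    Gl f q s t = Real.log (g t - g s) - Real.log (t - s) := by
  rw [h.Gl_ne q hst, h.hg t, h.hg s]
  congr 2; ring

lemma q4 (h : Dat f g q Q p M K V) : q ≤ 4 * Q := by have := h.qQ; omega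

/-- The three distortion errors. -/
lemma errs (h : Dat f g q Q p M K V) (y : ℝ) : ∃ e₁ e₂ e₃ : ℝ,
    |e₁| ≤ 36 * K * M ∧ |e₂| ≤ 36 * K * M ∧ |e₃| ≤ 36 * K * M ∧
    Gl f q y y = e₁ + 2 * Real.log (g (g y) - g y) + Real.log (g (g (g y)) - g y)
      - Real.log (g y - y) - Real.log (g (g (g y)) - g (g y)) - Real.log (g (g y) - y) ∧
    Gl f q (g y) (g y) = e₂ - Real.log (g (g (g y)) - g y) + Real.log (g (g y) - y)
      + Real.log (g (g (g y)) - g (g y)) - Real.log (g y - y) ∧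
    Gl f q (g (g y)) (g (g y)) = e₃ - 2 * Real.log (g (g y) - g y) + Real.log (g y - y)
      + Real.log (g (g (g y)) - g (g y)) + Real.log (g (g (g y)) - g y)
      - Real.log (g (g y) - y) := by
  have p1 := h.pos y
  have p2 := h.pos (g y)
  have p3 := h.pos (g (g y))
  have m0 : y ∈ Set.Icc y (g (g (g y))) := ⟨by linarith, by linarith⟩
  have m1 : g y ∈ Set.Icc y (g (g (g y))) := ⟨by linarith, by linarith⟩
  have m2 : g (g y) ∈ Set.Icc y (g (g (g y))) := ⟨by linarith, by linarith⟩
  have g01 := h.Gl_g p1.ne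
  have g10 := h.Gl_g p1.ne'
  have g12 := h.Gl_g p2.ne
  have g21 := h.Gl_g p2.ne'
  have g02 := h.Gl_g (p1.trans p2).ne
  rw [log_sub_comm (g y), log_sub_comm y] at g10
  rw [log_sub_comm (g (g y)), log_sub_comm (g y)] at g21
  refine ⟨_, _, _, h.mixG q h.q4 m0 m0 m2 m1, h.mixG q h.q4 m1 m1 m2 m0,
    h.mixG q h.q4 m2 m2 m1 m0, ?_, ?_, ?_⟩
  · rw [g12, g02, g10]; ring
  · rw [g12, g02, g01]; ring
  · rw [g21, g02, g01]; ring

lemma R_bounds (h : Dat f g q Q p M K V) (x : ℝ) :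
    g (g x) - g x ≤ 2 * Real.exp (8 * V) * (g x - x) ∧
    g x - x ≤ 2 * Real.exp (8 * V) * (g (g x) - g x) := by
  have h0 := abs_le.1 (h.lr_bdd x)
  have p1 := sub_pos.2 (h.pos x)
  have p2 := sub_pos.2 (h.pos (g x))
  have e : 2 * Real.exp (8 * V) = Real.exp (Real.log 2 + 8 * V) := by
    rw [Real.exp_add, Real.exp_log (by norm_num)]
  have aux : ∀ u v : ℝ, 0 < u → 0 < v → Real.log u - Real.log v ≤ Real.log 2 + 8 * V →
      u ≤ 2 * Real.exp (8 * V) * v := by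
    intro u v hu hv huv
    rw [e]
    have : Real.exp (Real.log u) ≤ Real.exp (Real.log 2 + 8 * V + Real.log v) :=
      Real.exp_le_exp.2 (by linarith)
    rwa [Real.exp_add _ (Real.log v), Real.exp_log hu, Real.exp_log hv] at this
  unfold lr at h0
  exact ⟨aux _ _ p2 p1 h0.2, aux _ _ p1 p2 (by linarith [h0.1])⟩

/-- Derivative of the cross-ratio. -/
lemma lk_deriv (h : Dat f g q Q p M K V) (R : ℝ) (hR : R = 2 * Real.exp (8 * V)) (y : ℝ) :
    ∃ d, HasDerivAt (lk g) d y ∧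
      |d| ≤ (2 * (R ^ 2 * (1 + R)) + 1) * (108 * K * Real.exp (108 * K) * M) / (g y - y) := by
  obtain ⟨e₁, e₂, e₃, h1, h2, h3, E1, E2, E3⟩ := h.errs y
  have p1 := h.pos y
  have p2 := h.pos (g y)
  have p3 := h.pos (g (g y))
  have d1 := h.hasDeriv_g y
  have d2 := (h.hasDeriv_g (g y)).comp y d1
  have d3 := (h.hasDeriv_g (g (g y))).comp y d2
  have hR1 := h.R_bounds y
  have hR2 := h.R_bounds (g y)
  rw [← hR] at hR1 hR2
  have hK := h.Kn
  have hM := h.Mpos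
  have hM1 := h.M1
  have hd := (((d1.sub (hasDerivAt_id y)).log (sub_pos.2 p1).ne').add
    ((d3.sub d2).log (sub_pos.2 p3).ne')).sub
    ((d2.sub (hasDerivAt_id y)).log (sub_pos.2 (p1.trans p2)).ne') |>.sub
    ((d3.sub d1).log (sub_pos.2 (p2.trans p3)).ne')
  refine ⟨_, hd, ?_⟩
  have hηx : ∀ e, |e| ≤ 108 * K * M → |Real.exp e - 1| ≤ 108 * K * Real.exp (108 * K) * M := by
    intro e he
    refine (abs_exp_sub_one e _ he).trans ?_
    have : Real.exp (108 * K * M) ≤ Real.exp (108 * K) := by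
      apply Real.exp_le_exp.2
      nlinarith
    calc 108 * K * M * Real.exp (108 * K * M) ≤ 108 * K * M * Real.exp (108 * K) := by gcongr
      _ = _ := by ring
  have hKM : 0 ≤ K * M := by positivity
  have x1 := hηx e₁ (by linarith)
  have x2 := hηx (e₁ + e₂) ((abs_add_le _ _).trans (by linarith))
  have x3 := hηx (e₁ + e₂ + e₃) ((abs_add_three _ _ _).trans (by linarith))
  have key := deriv_alg (sub_pos.2 p1) (sub_pos.2 p2) (sub_pos.2 p3) hR1.1 hR2.2 hR2.1 x1 x2 x3
  have ab : g y - y + (g (g y) - g y) = g (g y) - y := by ring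
  have bc : g (g y) - g y + (g (g (g y)) - g (g y)) = g (g (g y)) - g y := by ring
  rw [ab, bc] at key
  have a0 := sub_pos.2 p1
  have b0 := sub_pos.2 p2
  have c0 := sub_pos.2 p3
  have ab0 := sub_pos.2 (p1.trans p2)
  have bc0 := sub_pos.2 (p2.trans p3)
  have F1 : Real.exp (Gl f q y y) = Real.exp e₁ * ((g (g y) - g y) ^ 2 * (g (g (g y)) - g y) /
      ((g y - y) * (g (g (g y)) - g (g y)) * (g (g y) - y))) := by
    rw [E1, Real.exp_sub, Real.exp_sub, Real.exp_sub, Real.exp_add, Real.exp_add, two_mul,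
      Real.exp_add, Real.exp_log a0, Real.exp_log b0, Real.exp_log c0, Real.exp_log ab0,
      Real.exp_log bc0]
    field_simp
  have F2 : Real.exp (Gl f q (g y) (g y)) * Real.exp (Gl f q y y) =
      Real.exp (e₁ + e₂) * ((g (g y) - g y) ^ 2 / (g y - y) ^ 2) := by
    rw [F1, E2, Real.exp_sub, Real.exp_add, Real.exp_add, Real.exp_sub, Real.exp_add,
      Real.exp_log a0, Real.exp_log c0, Real.exp_log ab0, Real.exp_log bc0]
    field_simp
    try rw [← Real.exp_add]
  have F3 : Real.exp (Gl f q (g (g y)) (g (g y))) *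
      (Real.exp (Gl f q (g y) (g y)) * Real.exp (Gl f q y y)) =
      Real.exp (e₁ + e₂ + e₃) * ((g (g (g y)) - g (g y)) * (g (g (g y)) - g y) /
        ((g y - y) * (g (g y) - y))) := by
    rw [F2, E3, Real.exp_sub, Real.exp_add, Real.exp_add, Real.exp_add, Real.exp_sub, two_mul,
      Real.exp_add, Real.exp_add, Real.exp_add,
      Real.exp_log a0, Real.exp_log b0, Real.exp_log c0, Real.exp_log ab0, Real.exp_log bc0]
    field_simp
    try rw [← Real.exp_add]
  rw [F3, F2, F1]
  exact key

/-- Constant controlling the oscillation of the cross-ratio. -/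
lemma lk_local (h : Dat f g q Q p M K V) (R : ℝ) (hR : R = 2 * Real.exp (8 * V)) (x y : ℝ)
    (hy : y ∈ Set.Icc x (g x)) : |lk g y - lk g x| ≤
      (2 * (R ^ 2 * (1 + R)) + 1) * (108 * K * Real.exp (108 * K)) * (R * (1 + R)) * M := by
  have hR0 : 0 < R := by rw [hR]; positivity
  have hK := h.Kn
  have hM := h.Mpos
  set B := (2 * (R ^ 2 * (1 + R)) + 1) * (108 * K * Real.exp (108 * K) * M) with hB
  have hB0 : 0 ≤ B := by positivity
  have p1 := sub_pos.2 (h.pos x)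
  choose d hd hdb using h.lk_deriv R hR
  have low : ∀ z ∈ Set.Icc x (g x), g x - x ≤ R * (1 + R) * (g z - z) := by
    intro z hz
    have i1 := h.gmono.monotone hz.1
    have i2 := h.gmono.monotone hz.2
    have i3 := h.gmono.monotone i1
    have hRz := h.R_bounds z
    have hRx := h.R_bounds x
    rw [← hR] at hRz hRx
    have : g (g x) - g x ≤ (1 + R) * (g z - z) := by linarith [hz.2, hRz.1]
    nlinarith [hRx.2]
  have := Convex.norm_image_sub_le_of_norm_hasDerivWithin_le (f := lk g) (f' := d)
    (s := Set.Icc x (g x)) (C := B * (R * (1 + R)) / (g x - x))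
    (fun z _ => (hd z).hasDerivWithinAt) (by
      intro z hz
      have pz := sub_pos.2 (h.pos z)
      have hz' : ‖d z‖ ≤ B / (g z - z) := hdb z
      refine hz'.trans ?_
      rw [div_le_div_iff₀ pz p1, mul_assoc B]
      exact mul_le_mul_of_nonneg_left (low z hz) hB0) (convex_Icc _ _)
    (Set.left_mem_Icc.2 (h.pos x).le) hy
  rw [Real.norm_eq_abs, Real.norm_eq_abs] at this
  refine this.trans ?_
  have hyx : |y - x| ≤ g x - x := by rw [abs_of_nonneg (by linarith [hy.1])]; linarith [hy.2]
  calc _ ≤ B * (R * (1 + R)) / (g x - x) * (g x - x) := by gcongr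
    _ = _ := by rw [hB]; field_simp

lemma lk_global (h : Dat f g q Q p M K V) (R : ℝ) (hR : R = 2 * Real.exp (8 * V)) (W : ℝ)
    (hW : W = (2 * (R ^ 2 * (1 + R)) + 1) * (108 * K * Real.exp (108 * K)) * (R * (1 + R)) + 36 * K)
    (x y : ℝ) : |lk g y - lk g x| ≤ W * M := by
  obtain ⟨j, hj, k, h1, h2⟩ := h.cov x y
  have hqQ := h.qQ
  have a1 := h.lk_local R hR (f^[j] x + k) y ⟨h1, by rw [h.g_int]; exact h2⟩
  rw [h.lk_int] at a1
  have a2 := h.lk_iter j (by omega) x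
  have e : lk g y - lk g x = (lk g y - lk g (f^[j] x)) + (lk g (f^[j] x) - lk g x) := by ring
  rw [e, hW, add_mul]
  exact (abs_add_le _ _).trans (add_le_add a1 a2)

lemma g_cont (h : Dat f g q Q p M K V) : Continuous g :=
  continuous_iff_continuousAt.2 fun x => (h.hasDeriv_g x).continuousAt

lemma lk_lower (h : Dat f g q Q p M K V) (R : ℝ) (hR : R = 2 * Real.exp (8 * V)) (W : ℝ)
    (hW : W = (2 * (R ^ 2 * (1 + R)) + 1) * (108 * K * Real.exp (108 * K)) * (R * (1 + R)) + 36 * K)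
    (x : ℝ) : Real.log (1 / 4) - W * M ≤ lk g x := by
  have hc := h.g_cont
  obtain ⟨_, z, hz⟩ := periodic_bdd (φ := fun x => g x - x) (fun x => by
    have := h.g_int x 1
    push_cast at this
    simp only [this]; ring) (by fun_prop)
  obtain ⟨u, rfl⟩ := h.surj z
  have := kappa_ge (sub_pos.2 (h.pos (g u))) (hz u) (hz (g (g u)))
  have h1 := (abs_le.1 (h.lk_global R hR W hW u x)).1
  have ab : g u - u + (g (g u) - g u) = g (g u) - u := by ring
  have bc : g (g u) - g u + (g (g (g u)) - g (g u)) = g (g (g u)) - g u := by ring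
  rw [ab, bc] at this
  have e : lk g u = Real.log (g u - u) + Real.log (g (g (g u)) - g (g u)) -
    Real.log (g (g u) - u) - Real.log (g (g (g u)) - g u) := rfl
  linarith

lemma lr_small (h : Dat f g q Q p M K V) (R : ℝ) (hR : R = 2 * Real.exp (8 * V)) (W : ℝ)
    (hW : W = (2 * (R ^ 2 * (1 + R)) + 1) * (108 * K * Real.exp (108 * K)) * (R * (1 + R)) + 36 * K)
    (x : ℝ) : |lr g x| ≤ (1 + R) * Real.sqrt (W * M) := by
  have hc := h.g_cont
  have hR0 : 0 < R := by rw [hR]; positivity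
  have hK := h.Kn
  have hM := h.Mpos
  have hWM : 0 ≤ W * M := by rw [hW]; positivity
  have lrc : Continuous (lr g) := by
    unfold lr
    apply Continuous.sub
    · exact Continuous.log (by fun_prop) (fun x => (sub_pos.2 (h.pos (g x))).ne')
    · exact Continuous.log (by fun_prop) (fun x => (sub_pos.2 (h.pos x)).ne')
  obtain ⟨⟨z, hz⟩, w, hw⟩ := periodic_bdd (φ := lr g) (fun x => by
    have := h.lr_int x 1
    push_cast at this
    exact this) lrc
  have elr : ∀ u, lr g u = Real.log ((g (g u) - g u) / (g u - u)) := fun u => by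
    rw [Real.log_div (sub_pos.2 (h.pos (g u))).ne' (sub_pos.2 (h.pos u)).ne']; rfl
  have main : ∀ u, lr g (g u) ≤ lr g u →
      lr g u ≤ (1 + R) * Real.sqrt (W * M) ∧ -((1 + R) * Real.sqrt (W * M)) ≤ lr g (g u) := by
    intro u hu
    have a0 := sub_pos.2 (h.pos u)
    have b0 := sub_pos.2 (h.pos (g u))
    have c0 := sub_pos.2 (h.pos (g (g u)))
    have hR1 := h.R_bounds u
    have hR2 := h.R_bounds (g u)
    rw [← hR] at hR1 hR2
    have low := h.lk_lower R hR W hW u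
    rw [elr, elr] at *
    have hle := (Real.log_le_log_iff (by positivity) (by positivity)).1 hu
    have kk := kappa_le a0 b0 c0 hle
    have ab : g u - u + (g (g u) - g u) = g (g u) - u := by ring
    have bc : g (g u) - g u + (g (g (g u)) - g (g u)) = g (g (g u)) - g u := by ring
    rw [ab, bc] at kk
    constructor
    · refine log_upper (by positivity) ?_ hWM (sq_bound (by positivity) (low.trans kk.1))
      rw [div_le_iff₀ a0]; exact hR1.1
    · refine log_lower (by positivity) ?_ hWM (sq_bound (by positivity) (low.trans kk.2))
      rw [← mul_div_assoc, le_div_iff₀ b0, one_mul]; exact hR2.2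
  obtain ⟨v, rfl⟩ := h.surj w
  rw [abs_le]
  exact ⟨(main v (hw v)).2.trans (hw x), (hz x).trans (main z (hz _)).1⟩

lemma final (h : Dat f g q Q p M K V) (R : ℝ) (hR : R = 2 * Real.exp (8 * V)) (W : ℝ)
    (hW : W = (2 * (R ^ 2 * (1 + R)) + 1) * (108 * K * Real.exp (108 * K)) * (R * (1 + R)) + 36 * K)
    (x : ℝ) : |Real.log (deriv g x)| ≤
      (36 * K + 3 * ((1 + R) * Real.sqrt W) + 1) * Real.sqrt M := by
  have hK := h.Kn
  have hM := h.Mpos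
  have hM1 := h.M1
  have hR0 : 0 < R := by rw [hR]; positivity
  have hW0 : 0 ≤ W := by rw [hW]; positivity
  obtain ⟨e₁, _, _, h1, _, _, E1, _, _⟩ := h.errs x
  have l0 := h.lr_small R hR W hW x
  have l1 := h.lr_small R hR W hW (g x)
  rw [Real.sqrt_mul hW0] at l0 l1
  set N := (1 + R) * (Real.sqrt W * Real.sqrt M) with hN
  have hN0 : 0 ≤ N := by positivity
  have a0 := sub_pos.2 (h.pos x)
  have b0 := sub_pos.2 (h.pos (g x))
  have c0 := sub_pos.2 (h.pos (g (g x)))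
  rw [(h.hasDeriv_g x).deriv, Real.log_exp, E1]
  have hs : M ≤ Real.sqrt M := by
    have := Real.sqrt_le_sqrt hM1
    rw [Real.sqrt_one] at this
    nlinarith [Real.sq_sqrt hM.le, Real.sqrt_nonneg M]
  have l0' := abs_le.1 l0
  have l1' := abs_le.1 l1
  unfold lr at l0' l1'
  have aux : ∀ u v : ℝ, 0 < u → 0 < v → (Real.log u - Real.log v ≤ N ↔ u ≤ Real.exp N * v) := by
    intro u v hu hv
    rw [← Real.log_le_log_iff hu (by positivity), Real.log_mul (Real.exp_pos _).ne' hv.ne',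
      Real.log_exp]
    constructor <;> intro h <;> linarith
  have t1 := (aux _ _ b0 a0).1 l0'.2
  have t2 := (aux _ _ c0 b0).1 l1'.2
  have t3 := (aux _ _ a0 b0).1 (by linarith [l0'.1])
  have t4 := (aux _ _ b0 c0).1 (by linarith [l1'.1])
  have s1 := (aux (g (g (g x)) - g x) (g (g x) - x) (by linarith) (by linarith)).2 (by linarith)
  have s2 := (aux (g (g x) - x) (g (g (g x)) - g x) (by linarith) (by linarith)).2 (by linarith)
  have h1' := abs_le.1 h1
  have hf : 36 * K * M + 3 * N ≤ (36 * K + 3 * ((1 + R) * Real.sqrt W) + 1) * Real.sqrt M := by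
    have : 36 * K * M ≤ 36 * K * Real.sqrt M := by gcongr
    rw [hN]
    nlinarith [Real.sqrt_nonneg M]
  refine le_trans ?_ hf
  rw [abs_le]
  constructor <;> linarith [l0'.1, l0'.2, l1'.1, l1'.2, h1'.1, h1'.2]

end Dat

/-- The case of positive displacement. -/
lemma pos_case {f : ℝ → ℝ} (hf : ContDiff ℝ 3 f) (hm : StrictMono f)
    (hsurj : Function.Surjective f) (hder : ∀ x, 0 < deriv f x)
    (hper : ∀ x, f (x + 1) = f x + 1) {α : ℝ} (hα : Irrational α)
    (hrot : ∀ x : ℝ, Tendsto (fun m : ℕ => (f^[m] x - x) / m) atTop (𝓝 α)) :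
    ∃ C > (0 : ℝ), ∀ (q Q : ℕ) (p P : ℤ), CFPair α q Q p P → 0 < (q : ℝ) * α - p → ∀ x : ℝ,
      |Real.log (deriv (fun x => f^[q] x - p) x)| ≤
        C * Real.sqrt (⨆ y : ℝ, |f^[q] y - p - y|) := by
  obtain ⟨c, C₁, C₂, C₃, hb⟩ := exists_bds hf hder hper
  have hc := hb.cpos
  have h1 := hb.C₁_pos
  have h2 := hb.C₂_nonneg
  have h3 := hb.C₃_nonneg
  set K := (C₁ * C₃ + C₂ ^ 2) / c ^ 2 with hK
  set V := C₂ / c with hV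
  have hK0 : 0 ≤ K := by positivity
  have hV0 : 0 ≤ V := by positivity
  obtain ⟨R, hR⟩ : ∃ R, R = 2 * Real.exp (8 * V) := ⟨_, rfl⟩
  obtain ⟨W, hW⟩ : ∃ W, W = (2 * (R ^ 2 * (1 + R)) + 1) * (108 * K * Real.exp (108 * K)) *
    (R * (1 + R)) + 36 * K := ⟨_, rfl⟩
  have hR0 : 0 < R := by rw [hR]; positivity
  refine ⟨36 * K + 3 * ((1 + R) * Real.sqrt W) + 1, by positivity, ?_⟩
  intro q Q p P hcf hδ x
  set g : ℝ → ℝ := fun x => f^[q] x - p with hgdef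
  have hg : ∀ x, g x = f^[q] x - p := fun x => rfl
  have hlt := hcf.lt_one
  rw [abs_of_pos hδ] at hlt
  have hpos : ∀ x, x < g x := by
    intro x
    have := orbit_lt hper hm hrot 0 q 0 (-p) (by push_cast; linarith) x
    simp at this
    rw [hg]; linarith
  have hle1 : ∀ x, g x - x ≤ 1 := by
    intro x
    have := orbit_lt hper hm hrot q 0 (-p) 1 (by push_cast; linarith) x
    simp at this
    rw [hg]; linarith
  have hcont : Continuous g := by
    have := hf.continuous.iterate q
    rw [hgdef]; fun_prop
  obtain ⟨⟨Y, hY⟩, _⟩ := periodic_bdd (φ := fun x => g x - x) (fun x => by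
    have := iter_add_int hper hm q x 1
    push_cast at this
    simp only [hg, this]; ring) (by fun_prop)
  have hD : Dat f g q Q p (g Y - Y) K V :=
    { smooth := hf, mono := hm, per := hper, slpos := hb.slp_pos, lip := hb.log_slp_lip
      mix := hb.log_slp_mixed, Vn := hV0, Kn := hK0, hg := hg, pos := hpos
      surj := by
        intro y
        obtain ⟨x, hx⟩ := hsurj.iterate q (y + p)
        exact ⟨x, by rw [hg, hx]; ring⟩
      qQ := hcf.q_le, leM := hY, maxM := ⟨Y, rfl⟩, M1 := hle1 Y
      sum := sum_le_one hper hm hα hrot hg hcf hδ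
      cov := orbit_cover hper hm hα hrot hg hcf hδ }
  refine (hD.final R hR W hW x).trans ?_
  have hsup : g Y - Y ≤ ⨆ y : ℝ, |f^[q] y - p - y| := by
    have hbd : BddAbove (Set.range fun y : ℝ => |f^[q] y - p - y|) := by
      refine ⟨1, ?_⟩
      rintro _ ⟨y, rfl⟩
      have a1 := hpos y
      have a2 := hle1 y
      rw [hg] at a1 a2
      show |f^[q] y - p - y| ≤ 1
      rw [abs_le]; constructor <;> linarith
    exact (le_abs_self _).trans (le_ciSup hbd Y)
  gcongr

theorem log_deriv_aux
    (g : ℝ → ℝ) (hg : ContDiff ℝ 3 g) (hgmono : StrictMono g)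
    (hgsurj : Function.Surjective g) (hgder : ∀ x, 0 < deriv g x)
    (hgper : ∀ x, g (x + 1) = g x + 1)
    (α : ℝ) (hα : Irrational α)
    (hrot : ∀ x : ℝ, Tendsto (fun m : ℕ => (g^[m] x - x) / m) atTop (𝓝 α)) :
    ∃ C > (0 : ℝ), ∀ n : ℕ, ∀ x : ℝ,
      |Real.log (deriv (cfIter g α n) x)| ≤
        C * Real.sqrt (⨆ y : ℝ, |cfIter g α n y - y|) := by
  obtain ⟨A, hA, hA'⟩ := pos_case hg hgmono hgsurj hgder hgper hα hrot
  set f : ℝ → ℝ := fun x => -g (-x) with hf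
  have hit : ∀ (i : ℕ) x, f^[i] x = -g^[i] (-x) := by
    intro i
    induction i with
    | zero => intro x; simp
    | succ i ih => intro x; rw [Function.iterate_succ_apply', ih, Function.iterate_succ_apply', hf]; simp
  have hfd : ContDiff ℝ 3 f := (hg.comp contDiff_neg).neg
  have hfm : StrictMono f := fun x y hxy => neg_lt_neg (hgmono (neg_lt_neg hxy))
  have hfs : Function.Surjective f := fun y => by
    obtain ⟨x, hx⟩ := hgsurj (-y)
    exact ⟨-x, by simp [hf, hx]⟩
  have hfder : ∀ x, 0 < deriv f x := fun x => by
    have e : f = fun x => -(fun z => g (-z)) x := rfl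
    rw [e, deriv.fun_neg, deriv_comp_neg]
    simpa using hgder (-x)
  have hfper : ∀ x, f (x + 1) = f x + 1 := fun x => by
    have := hgper (-(x + 1))
    rw [show -(x + 1) + 1 = -x by ring] at this
    simp only [hf]; linarith
  have hfrot : ∀ x : ℝ, Tendsto (fun m : ℕ => (f^[m] x - x) / m) atTop (𝓝 (-α)) := fun x => by
    refine ((hrot (-x)).neg).congr (fun m => ?_)
    rw [hit]; ring
  obtain ⟨B, hB, hB'⟩ := pos_case hfd hfm hfs hfder hfper hα.neg hfrot
  refine ⟨A + B, by positivity, fun n x => ?_⟩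
  have hcf := cf_pair hα n
  set q := cfQ α n
  set Q := cfQ α (n + 1)
  set p := cfP α n with hp
  set P := cfP α (n + 1)
  have e1 : cfIter g α n = fun x => g^[q] x - p := rfl
  have hs0 := Real.sqrt_nonneg (⨆ y : ℝ, |cfIter g α n y - y|)
  rcases lt_or_gt_of_ne (cf_ne hα n) with hneg | hpos
  · have hcf' : CFPair (-α) q Q (-p) (-P) := by
      have en : ∀ (i : ℕ) (k : ℤ), (i : ℝ) * -α - (-k : ℤ) = -(i * α - k) := fun i k => by
        push_cast; ring
      refine ⟨hcf.q_pos, hcf.q_le, ?_, ?_, ?_, ?_⟩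
      · rw [en, abs_neg]; exact hcf.lt_one
      · rw [en, en, neg_mul_neg]; exact hcf.opp
      · rw [en, en, abs_neg, abs_neg]; exact hcf.le
      · intro i h0 hi k
        have := hcf.best i h0 hi (-k)
        have e2 := en i (-k)
        rw [neg_neg] at e2
        rw [en, e2, abs_neg, abs_neg]; exact this
    have := hB' q Q (-p) (-P) hcf' (by push_cast; linarith) (-x)
    have ed : deriv (fun x => f^[q] x - ((-p : ℤ) : ℝ)) (-x) = deriv (cfIter g α n) x := by
      have : (fun x => f^[q] x - ((-p : ℤ) : ℝ)) = fun x => -(fun z => cfIter g α n (-z)) x := by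
        funext z; rw [hit, e1]; push_cast; ring
      rw [this, deriv.fun_neg, deriv_comp_neg]
      simp
    have es : (⨆ y : ℝ, |f^[q] y - ((-p : ℤ) : ℝ) - y|) = ⨆ y : ℝ, |cfIter g α n y - y| := by
      rw [← (Equiv.neg ℝ).iSup_comp]
      congr 1
      funext y
      rw [hit, e1, ← abs_neg]
      congr 1
      simp; ring
    rw [ed, es] at this
    nlinarith
  · have := hA' q Q p P hcf hpos x
    rw [← e1] at this
    have es : (⨆ y : ℝ, |g^[q] y - p - y|) = ⨆ y : ℝ, |cfIter g α n y - y| := rfl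
    rw [es] at this
    nlinarith

/-- **Denjoy-type estimate.**
Let `g` be the lift of an orientation-preserving `C³` circle diffeomorphism with irrational
rotation number `α`.  There is a constant `C > 0` (depending only on `g`) such that for all
`n`, `sup_x |log gₙ′(x)| ≤ C Mₙ^{1/2}`, where `gₙ(x) = g^{qₙ}(x) − pₙ`. -/
theorem log_deriv_renormalized_estimate
    (g : ℝ → ℝ) (hg : ContDiff ℝ 3 g) (hgmono : StrictMono g)
    (hgsurj : Function.Surjective g) (hgder : ∀ x, 0 < deriv g x)
    (hgper : ∀ x, g (x + 1) = g x + 1)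
    (α : ℝ) (hα : Irrational α)
    (hrot : ∀ x : ℝ, Tendsto (fun m : ℕ => (g^[m] x - x) / m) atTop (𝓝 α)) :
    ∃ C > (0 : ℝ), ∀ n : ℕ, ∀ x : ℝ,
      |Real.log (deriv (cfIter g α n) x)| ≤
        C * Real.sqrt (⨆ y : ℝ, |cfIter g α n y - y|) := by
  exact log_deriv_aux g hg hgmono hgsurj hgder hgper α hα hrot
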